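/- Let U ⊆ ℝⁿ be an open box (product of open intervals), α ∈ ℕⁿ a multi-index, and f, g continuous on U. Then the distributional derivatives D^α f and D^α g (of f and g viewed as distributions on U) are equal if and only if f − g = θ₁ + ⋯ + θₙ, where each θ_k is a polynomial in x_k of degree < α_k whose coefficients are continuous functions on U not depending on x_k. -/

import Mathlib

open MeasureTheory

/-- Partial derivative of `φ` in the `k`-th variable. -/
noncomputable def pd {n : ℕ} (k : Fin n) (φ : (Fin n → ℝ) → ℝ) : (Fin n → ℝ) → ℝ :=
  fun x => deriv (fun t => φ (Function.update x k t)) (x k)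

/-- Iterated partial derivative `∂^α`. -/
noncomputable def multiPD {n : ℕ} (α : Fin n → ℕ) (φ : (Fin n → ℝ) → ℝ) :
    (Fin n → ℝ) → ℝ :=
  (List.finRange n).foldr (fun k ψ => (pd k)^[α k] ψ) φ

structure IsTest {X : Type*} [NormedAddCommGroup X] [NormedSpace ℝ X] (U : Set X) (φ : X → ℝ) :
    Prop where
  smooth : ContDiff ℝ (⊤ : ℕ∞) φ
  cpt : HasCompactSupport φ
  supp : tsupport φ ⊆ U

section general
variable {X : Type*} [NormedAddCommGroup X] [NormedSpace ℝ X] {U : Set X} {φ : X → ℝ}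

lemma IsTest.zero_of_notMem (h : IsTest U φ) {x : X} (hx : x ∉ U) : φ x = 0 :=
  image_eq_zero_of_notMem_tsupport fun h' => hx (h.supp h')

lemma IsTest.continuous_mul (h : IsTest U φ) (hU : IsOpen U) {u : X → ℝ}
    (hu : ContinuousOn u U) : Continuous (fun x => u x * φ x) := by
  rw [continuous_iff_continuousAt]
  intro x
  by_cases hx : x ∈ tsupport φ
  · exact (hu.continuousAt (hU.mem_nhds (h.supp hx))).mul h.smooth.continuous.continuousAt
  · have : (fun x => u x * φ x) =ᶠ[nhds x] fun _ => 0 := by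
      filter_upwards [(isClosed_tsupport φ).isOpen_compl.mem_nhds hx] with y hy
      rw [image_eq_zero_of_notMem_tsupport hy, mul_zero]
    exact continuousAt_const.congr this.symm

lemma IsTest.cpt_mul (h : IsTest U φ) (u : X → ℝ) : HasCompactSupport (fun x => u x * φ x) :=
  h.cpt.mul_left

lemma IsTest.integrable_mul [MeasurableSpace X] [BorelSpace X] {μ : Measure X}
    [IsFiniteMeasureOnCompacts μ] (h : IsTest U φ) (hU : IsOpen U) {u : X → ℝ}
    (hu : ContinuousOn u U) : Integrable (fun x => u x * φ x) μ :=
  (h.continuous_mul hU hu).integrable_of_hasCompactSupport (h.cpt_mul u)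

lemma IsTest.setIntegral [MeasurableSpace X] {μ : Measure X}
    (h : IsTest U φ) (u : X → ℝ) : ∫ x in U, u x * φ x ∂μ = ∫ x, u x * φ x ∂μ :=
  setIntegral_eq_integral_of_forall_compl_eq_zero fun x hx => by
    rw [h.zero_of_notMem hx, mul_zero]

lemma IsTest.sub {ψ : X → ℝ} (h : IsTest U φ) (h' : IsTest U ψ) :
    IsTest U (fun x => φ x - ψ x) where
  smooth := h.smooth.sub h'.smooth
  cpt := h.cpt.sub h'.cpt
  supp := (tsupport_sub φ ψ).trans (Set.union_subset h.supp h'.supp)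

lemma IsTest.mul_const (h : IsTest U φ) (c : ℝ) :
    IsTest U (fun x => φ x * c) where
  smooth := h.smooth.mul contDiff_const
  cpt := h.cpt.mul_right
  supp := (tsupport_mul_subset_left).trans h.supp

lemma IsTest.zero : IsTest U (fun _ => (0 : ℝ)) where
  smooth := contDiff_const
  cpt := HasCompactSupport.zero
  supp := by simp [tsupport]

lemma IsTest.sub_sum {f : ℕ → X → ℝ} (h : IsTest U φ) (hf : ∀ i, IsTest U (f i)) (m : ℕ) :
    IsTest U (fun x => φ x - ∑ i ∈ Finset.range m, f i x) := by
  induction m with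
  | zero => simpa using h
  | succ m ih =>
    convert ih.sub (hf m) using 2
    rw [Finset.sum_range_succ]; ring

end general

section oneD
variable {I : Set ℝ} {φ : ℝ → ℝ}

lemma IsTest.deriv (h : IsTest I φ) : IsTest I (deriv φ) where
  smooth := (contDiff_infty_iff_deriv.1 h.smooth).2
  cpt := h.cpt.deriv
  supp := tsupport_deriv_subset.trans h.supp

lemma IsTest.iteratedDeriv (h : IsTest I φ) (m : ℕ) : IsTest I (iteratedDeriv m φ) := by
  induction m with
  | zero => simpa using h
  | succ m ih => rw [iteratedDeriv_succ]; exact ih.deriv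

lemma IsTest.hasDerivAt (h : IsTest I φ) (x : ℝ) : HasDerivAt φ (_root_.deriv φ x) x :=
  ((contDiff_infty_iff_deriv.1 h.smooth).1 x).hasDerivAt

lemma IsTest.univ (h : IsTest I φ) : IsTest Set.univ φ := ⟨h.smooth, h.cpt, Set.subset_univ _⟩

lemma IsTest.int_pow (h : IsTest I φ) (j : ℕ) : Integrable (fun s => s ^ j * φ s) :=
  h.univ.integrable_mul isOpen_univ (by fun_prop)

lemma moment_deriv (h : IsTest I φ) (j : ℕ) :
    ∫ s, s ^ (j + 1) * deriv φ s = - ((j + 1 : ℝ) * ∫ s, s ^ j * φ s) := by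
  have := integral_mul_deriv_eq_deriv_mul_of_integrable (u := fun s : ℝ => s ^ (j + 1))
    (u' := fun s => (j + 1 : ℝ) * s ^ j) (v := φ) (v' := deriv φ)
    (fun x _ => by simpa using hasDerivAt_pow (j + 1) x) (fun x _ => h.hasDerivAt x)
    (h.deriv.int_pow _) (by
      convert (h.int_pow j).const_mul (j + 1 : ℝ) using 2
      simp [mul_assoc]) (h.int_pow _)
  rw [this, ← integral_const_mul]
  simp only [mul_assoc]

lemma moment_deriv_zero (h : IsTest I φ) : ∫ s, deriv φ s = 0 :=
  integral_eq_zero_of_hasDerivAt_of_integrable h.hasDerivAt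
    (by simpa using h.deriv.int_pow 0) (by simpa using h.int_pow 0)

lemma moment_iteratedDeriv (h : IsTest I φ) (m : ℕ) :
    ∀ j < m, ∫ s, s ^ j * iteratedDeriv m φ s = 0 := by
  induction m with
  | zero => simp
  | succ m ih =>
    intro j hj
    rw [iteratedDeriv_succ]
    cases j with
    | zero => simpa using moment_deriv_zero (h.iteratedDeriv m)
    | succ j => rw [moment_deriv (h.iteratedDeriv m), ih j (by omega)]; simp

lemma moment_iteratedDeriv_self (h : IsTest I φ) (h1 : ∫ s, φ s ≠ 0) (m : ℕ) :
    ∫ s, s ^ m * iteratedDeriv m φ s ≠ 0 := by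
  induction m with
  | zero => simpa using h1
  | succ m ih =>
    rw [iteratedDeriv_succ, moment_deriv (h.iteratedDeriv m)]
    have : (m + 1 : ℝ) ≠ 0 := by positivity
    exact neg_ne_zero.2 (mul_ne_zero this ih)

lemma exists_primitive {a b : ℝ} {η : ℝ → ℝ} (h : IsTest (Set.Ioo a b) η) (h0 : ∫ s, η s = 0) :
    ∃ ψ, IsTest (Set.Ioo a b) ψ ∧ deriv ψ = η := by
  by_cases hne : (tsupport η).Nonempty
  swap
  · rw [Set.not_nonempty_iff_eq_empty, tsupport_eq_empty_iff] at hne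
    subst hne
    exact ⟨fun _ => 0, IsTest.zero, by ext; simp⟩
  have hc : IsCompact (tsupport η) := h.cpt
  obtain ⟨a', ha', hla⟩ := hc.exists_isLeast hne
  obtain ⟨b', hb', hub⟩ := hc.exists_isGreatest hne
  have hsub : ∀ x, η x ≠ 0 → x ∈ Set.Icc a' b' := fun x hx =>
    ⟨hla (subset_tsupport _ hx), hub (subset_tsupport _ hx)⟩
  have hz : ∀ x, x ∉ Set.Icc a' b' → η x = 0 := fun x hx => by
    by_contra h'; exact hx (hsub x h')
  have hcont := h.smooth.continuous
  have hab : a' ≤ b' := hub ha'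
  let ψ : ℝ → ℝ := fun x => ∫ t in a'..x, η t
  have hd : ∀ x, HasDerivAt ψ (η x) x := fun x =>
    (hcont.integral_hasStrictDerivAt a' x).hasDerivAt
  have hd' : deriv ψ = η := funext fun x => (hd x).deriv
  have hs : tsupport ψ ⊆ Set.Icc a' b' := by
    refine closure_minimal ?_ isClosed_Icc
    intro x hx
    by_contra hx'
    apply hx
    rw [Set.mem_Icc, not_and_or, not_le, not_le] at hx'
    have hηa : η a' = 0 ∨ True := Or.inr trivial
    rcases hx' with hx' | hx'
    · change ∫ t in a'..x, η t = 0
      rw [intervalIntegral.integral_symm, intervalIntegral.integral_of_le hx'.le,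
        ← integral_Ico_eq_integral_Ioc, setIntegral_eq_zero_of_forall_eq_zero, neg_zero]
      intro t ht
      exact hz t fun h' => absurd h'.1 (not_le.2 ht.2)
    · change ∫ t in a'..x, η t = 0
      rw [intervalIntegral.integral_of_le (hab.trans hx'.le), ← integral_Icc_eq_integral_Ioc,
        setIntegral_eq_integral_of_forall_compl_eq_zero, h0]
      intro t ht
      exact hz t fun h' => ht ⟨h'.1, h'.2.trans hx'.le⟩
  refine ⟨ψ, ⟨?_, HasCompactSupport.of_support_subset_isCompact isCompact_Icc
    ((subset_tsupport _).trans hs), hs.trans ?_⟩, hd'⟩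
  · rw [contDiff_infty_iff_deriv, hd']
    exact ⟨fun x => (hd x).differentiableAt, h.smooth⟩
  · intro x hx
    exact ⟨(h.supp ha').1.trans_le hx.1, hx.2.trans_lt (h.supp hb').2⟩

lemma exists_iter_primitive {a b : ℝ} (m : ℕ) : ∀ {η : ℝ → ℝ}, IsTest (Set.Ioo a b) η →
    (∀ j < m, ∫ s, s ^ j * η s = 0) →
    ∃ ψ, IsTest (Set.Ioo a b) ψ ∧ iteratedDeriv m ψ = η := by
  induction m with
  | zero => intro η h _; exact ⟨η, h, by simp⟩
  | succ m ih =>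
    intro η h hm
    obtain ⟨ψ1, h1, rfl⟩ := exists_primitive h (by simpa using hm 0 (by omega))
    obtain ⟨ψ, h2, rfl⟩ := ih h1 (fun j hj => by
      have := hm (j + 1) (by omega)
      rw [moment_deriv h1] at this
      have h3 : (j + 1 : ℝ) ≠ 0 := by positivity
      simpa [h3] using this)
    exact ⟨ψ, h2, iteratedDeriv_succ⟩

lemma exists_bump (a : ℝ) {ε : ℝ} (hε : 0 < ε) :
    ∃ χ : ℝ → ℝ, IsTest (Metric.ball a ε) χ ∧ (∀ x, 0 ≤ χ x) ∧ 0 < χ a ∧ ∫ s, χ s ≠ 0 := by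
  let f : ContDiffBump a := ⟨ε / 4, ε / 2, by positivity, by linarith⟩
  refine ⟨f, ⟨f.contDiff, f.hasCompactSupport, ?_⟩, fun x => f.nonneg, ?_, f.integral_pos.ne'⟩
  · rw [f.tsupport_eq]
    exact Metric.closedBall_subset_ball (by change ε / 2 < ε; linarith)
  · exact f.pos_of_mem_ball (Metric.mem_ball_self f.rOut_pos)

lemma exists_dual (a : ℝ) {r : ℝ} (hr : 0 < r) (m : ℕ) :
    ∃ ρ : ℕ → ℝ → ℝ, (∀ j, IsTest (Set.Ioo (a - r) (a + r)) (ρ j)) ∧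
      ∀ i < m, ∀ j < m, ∫ s, s ^ j * ρ i s = if i = j then 1 else 0 := by
  induction m with
  | zero => exact ⟨fun _ _ => 0, fun _ => IsTest.zero, by simp⟩
  | succ m ih =>
    obtain ⟨ρ, h1, h2⟩ := ih
    obtain ⟨χ, hχ, -, -, hne⟩ := exists_bump a hr
    rw [Real.ball_eq_Ioo] at hχ
    have hm := moment_iteratedDeriv_self hχ hne m
    set M := ∫ s, s ^ m * iteratedDeriv m χ s
    let σ : ℝ → ℝ := fun s => iteratedDeriv m χ s * M⁻¹
    have hσ : IsTest (Set.Ioo (a - r) (a + r)) σ := (hχ.iteratedDeriv m).mul_const _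
    have hσm : ∀ j ≤ m, ∫ s, s ^ j * σ s = if m = j then 1 else 0 := by
      intro j hj
      simp only [σ, ← mul_assoc]
      rw [integral_mul_const]
      split_ifs with h
      · subst h; exact mul_inv_cancel₀ hm
      · rw [moment_iteratedDeriv hχ m j (by omega), zero_mul]
    refine ⟨fun i => if i = m then σ else fun s => ρ i s - σ s * ∫ s, s ^ m * ρ i s, ?_, ?_⟩
    · intro j
      by_cases h : j = m
      · simpa [h] using hσ
      · simpa [h] using (h1 j).sub (hσ.mul_const _)
    · intro i hi j hj
      by_cases h : i = m
      · simpa [h] using hσm j (by omega)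
      · simp only [h, if_false, mul_sub, ← mul_assoc]
        rw [integral_sub ((h1 i).int_pow j) ((hσ.int_pow j).mul_const _), integral_mul_const,
          hσm j (by omega)]
        by_cases h' : j = m
        · subst h'; simp [h]
        · rw [h2 i (by omega) j (by omega)]
          simp [Ne.symm h']

end oneD

section nD
variable {n : ℕ} {U : Set (Fin n → ℝ)} {φ : (Fin n → ℝ) → ℝ}

lemma pd_eq_fderiv (k : Fin n) (h : ContDiff ℝ (⊤ : ℕ∞) φ) :
    pd k φ = fun x => fderiv ℝ φ x (Pi.single k 1) := by
  ext x
  have hd : HasFDerivAt φ (fderiv ℝ φ x) (Function.update x k (x k)) := by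
    rw [Function.update_eq_self]
    exact (h.differentiable (by simp) x).hasFDerivAt
  exact (hd.comp_hasDerivAt (x k) (hasDerivAt_update x k (x k))).deriv

lemma pd_smooth (k : Fin n) (h : ContDiff ℝ (⊤ : ℕ∞) φ) : ContDiff ℝ (⊤ : ℕ∞) (pd k φ) := by
  rw [pd_eq_fderiv k h]
  exact (h.fderiv_right (m := (⊤ : ℕ∞)) (by simp)).clm_apply contDiff_const

lemma IsTest.pd (k : Fin n) (h : IsTest U φ) : IsTest U (pd k φ) := by
  have hs : tsupport (_root_.pd k φ) ⊆ tsupport φ := by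
    rw [pd_eq_fderiv k h.smooth]
    refine (closure_mono ?_).trans (tsupport_fderiv_subset ℝ)
    intro x hx hx'
    apply hx
    simp [hx']
  exact ⟨pd_smooth k h.smooth, h.cpt.mono' ((subset_tsupport _).trans hs), hs.trans h.supp⟩

lemma IsTest.pd_iter (k : Fin n) (m : ℕ) (h : IsTest U φ) : IsTest U ((_root_.pd k)^[m] φ) := by
  induction m with
  | zero => simpa using h
  | succ m ih => rw [Function.iterate_succ_apply']; exact ih.pd k

lemma pd_comm (k l : Fin n) (h : ContDiff ℝ (⊤ : ℕ∞) φ) : pd k (pd l φ) = pd l (pd k φ) := by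
  rw [pd_eq_fderiv k (pd_smooth l h), pd_eq_fderiv l (pd_smooth k h), pd_eq_fderiv k h,
    pd_eq_fderiv l h]
  ext x
  have hd : DifferentiableAt ℝ (fderiv ℝ φ) x :=
    (h.fderiv_right (m := (⊤ : ℕ∞)) (by simp)).differentiable (by simp) x
  have hsym : IsSymmSndFDerivAt ℝ φ x := h.contDiffAt.isSymmSndFDerivAt (by
    rw [minSmoothness_of_isRCLikeNormedField]
    exact WithTop.coe_le_coe.2 le_top)
  have e : ∀ v, fderiv ℝ (fun x => fderiv ℝ φ x v) x = (fderiv ℝ (fderiv ℝ φ) x).flip v := by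
    intro v
    rw [fderiv_clm_apply hd (differentiableAt_const v)]
    ext; simp
  rw [e, e]
  exact hsym _ _

lemma pd_comm_iter (k l : Fin n) (p : ℕ) (h : IsTest U φ) :
    pd k ((pd l)^[p] φ) = (pd l)^[p] (pd k φ) := by
  induction p with
  | zero => simp
  | succ p ih =>
    rw [Function.iterate_succ_apply', Function.iterate_succ_apply',
      pd_comm k l (h.pd_iter l p).smooth, ih]

lemma pd_iter_comm (k l : Fin n) (p q : ℕ) (h : IsTest U φ) :
    (pd k)^[q] ((pd l)^[p] φ) = (pd l)^[p] ((pd k)^[q] φ) := by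
  induction q with
  | zero => simp
  | succ q ih =>
    rw [Function.iterate_succ_apply', Function.iterate_succ_apply', ih,
      pd_comm_iter k l p (h.pd_iter k q)]

lemma IsTest.foldr (α : Fin n → ℕ) (L : List (Fin n)) (h : IsTest U φ) :
    IsTest U (L.foldr (fun k ψ => (_root_.pd k)^[α k] ψ) φ) := by
  induction L with
  | nil => simpa using h
  | cons i L ih => exact ih.pd_iter i _

lemma foldr_extract (α : Fin n → ℕ) (k : Fin n) (L : List (Fin n)) (h : IsTest U φ) (hk : k ∈ L) :
    ∃ ψ, IsTest U ψ ∧ L.foldr (fun k ψ => (pd k)^[α k] ψ) φ = (pd k)^[α k] ψ := by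
  induction L with
  | nil => simp at hk
  | cons i L ih =>
    by_cases hki : k = i
    · subst hki
      exact ⟨_, h.foldr α L, rfl⟩
    · obtain ⟨ψ, h1, h2⟩ := ih (by simpa [hki] using hk)
      refine ⟨_, h1.pd_iter i (α i), ?_⟩
      rw [List.foldr_cons, h2, pd_iter_comm i k _ _ h1]

lemma pd_iter_apply (k : Fin n) (m : ℕ) (φ : (Fin n → ℝ) → ℝ) (x : Fin n → ℝ) (t : ℝ) :
    (pd k)^[m] φ (Function.update x k t) =
      iteratedDeriv m (fun s => φ (Function.update x k s)) t := by
  induction m generalizing t with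
  | zero => simp
  | succ m ih =>
    rw [Function.iterate_succ_apply', iteratedDeriv_succ]
    simp only [pd, Function.update_idem, Function.update_self]
    congr 1
    ext s
    exact ih s

lemma pd_iter_prod (k : Fin n) (m : ℕ) (η : Fin n → ℝ → ℝ) :
    (pd k)^[m] (fun x => ∏ i, η i (x i)) =
      fun x => ∏ i, (Function.update η k (iteratedDeriv m (η k))) i (x i) := by
  ext x
  have := pd_iter_apply k m (fun x => ∏ i, η i (x i)) x (x k)
  rw [Function.update_eq_self] at this
  rw [this]
  have e : (fun s => ∏ i, η i (Function.update x k s i)) =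
      fun s => (∏ i ∈ Finset.univ.erase k, η i (x i)) * η k s := by
    ext s
    rw [← Finset.prod_erase_mul _ _ (Finset.mem_univ k), Function.update_self]
    congr 1
    refine Finset.prod_congr rfl fun i hi => ?_
    rw [Function.update_of_ne (Finset.ne_of_mem_erase hi)]
  rw [e, iteratedDeriv_const_mul_field, ← Finset.prod_erase_mul _ _ (Finset.mem_univ k),
    Function.update_self]
  congr 1
  refine Finset.prod_congr rfl fun i hi => ?_
  rw [Function.update_of_ne (Finset.ne_of_mem_erase hi)]

lemma foldr_prod (α : Fin n → ℕ) (η : Fin n → ℝ → ℝ) (L : List (Fin n)) (hL : L.Nodup) :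
    L.foldr (fun k ψ => (pd k)^[α k] ψ) (fun x => ∏ i, η i (x i)) =
      fun x => ∏ i, (if i ∈ L then iteratedDeriv (α i) (η i) else η i) (x i) := by
  induction L with
  | nil => simp
  | cons k L ih =>
    rw [List.nodup_cons] at hL
    rw [List.foldr_cons, ih hL.2, pd_iter_prod k (α k) (fun i => if i ∈ L then _ else _)]
    ext x
    refine Finset.prod_congr rfl fun i _ => ?_
    by_cases h : i = k
    · subst h; simp [hL.1]
    · simp [h]

lemma multiPD_prod (α : Fin n → ℕ) (η : Fin n → ℝ → ℝ) :
    multiPD α (fun x => ∏ i, η i (x i)) = fun x => ∏ i, iteratedDeriv (α i) (η i) (x i) := by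
  rw [multiPD, foldr_prod _ _ _ (List.nodup_finRange n)]
  simp

lemma isTest_prod {J : Fin n → Set ℝ} {η : Fin n → ℝ → ℝ} (h : ∀ i, IsTest (J i) (η i)) :
    IsTest (Set.univ.pi J) (fun x => ∏ i, η i (x i)) := by
  have hc : IsCompact (Set.univ.pi fun i => tsupport (η i)) :=
    isCompact_univ_pi fun i => (h i).cpt
  have hs : Function.support (fun x : Fin n → ℝ => ∏ i, η i (x i)) ⊆
      Set.univ.pi fun i => tsupport (η i) := by
    intro x hx i _
    exact subset_tsupport _ (Finset.prod_ne_zero_iff.1 hx i (Finset.mem_univ i))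
  refine ⟨contDiff_prod fun i _ => (h i).smooth.comp (contDiff_apply ℝ ℝ i),
    HasCompactSupport.of_support_subset_isCompact hc hs,
    (closure_minimal hs hc.isClosed).trans (Set.pi_mono fun i _ => (h i).supp)⟩

lemma eq_zero_of_test {J : Fin n → Set ℝ} (hJ : ∀ i, IsOpen (J i)) {u : (Fin n → ℝ) → ℝ}
    (hu : ContinuousOn u (Set.univ.pi J))
    (h : ∀ η : Fin n → ℝ → ℝ, (∀ i, IsTest (J i) (η i)) → ∫ x, u x * ∏ i, η i (x i) = 0) :
    ∀ x ∈ Set.univ.pi J, u x = 0 := by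
  intro x hx
  by_contra hne
  have hO : IsOpen (Set.univ.pi J) := isOpen_set_pi Set.finite_univ fun i _ => hJ i
  have hcont : ContinuousAt (fun y => u x * u y) x :=
    continuousAt_const.mul (hu.continuousAt (hO.mem_nhds hx))
  have hpos : 0 < u x * u x := mul_self_pos.2 hne
  obtain ⟨ε, hε, hb⟩ := Metric.mem_nhds_iff.1
    (Filter.inter_mem (hcont.eventually (lt_mem_nhds hpos)) (hO.mem_nhds hx))
  choose χ h1 h2 h3 h4 using fun i => exists_bump (x i) hε
  have hball : (Set.univ.pi fun i => Metric.ball (x i) ε) = Metric.ball x ε :=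
    (ball_pi x hε).symm
  have hJ' : ∀ i, Metric.ball (x i) ε ⊆ J i := by
    intro i t ht
    have : Function.update x i t ∈ Metric.ball x ε := by
      rw [← hball]
      intro j _
      by_cases hj : j = i
      · subst hj; simpa using ht
      · simpa [hj] using hε
    simpa using (hb this).2 i (Set.mem_univ i)
  have hT := isTest_prod h1
  rw [hball] at hT
  have hT' : ∀ i, IsTest (J i) (χ i) := fun i => ⟨(h1 i).smooth, (h1 i).cpt, (h1 i).supp.trans (hJ' i)⟩
  have hz := h χ hT'
  have hp : 0 < ∫ y, (u x * u y) * ∏ i, χ i (y i) := by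
    refine Continuous.integral_pos_of_hasCompactSupport_nonneg_nonzero (x := x)
      ((isTest_prod hT').continuous_mul hO (continuousOn_const.mul hu))
      ((isTest_prod hT').cpt_mul _) ?_ ?_
    · intro y
      by_cases hy : y ∈ Metric.ball x ε
      · exact mul_nonneg (hb hy).1.le (Finset.prod_nonneg fun i _ => h2 i _)
      · simp [hT.zero_of_notMem hy]
    · exact mul_ne_zero hpos.ne' (Finset.prod_ne_zero_iff.2 fun i _ => (h3 i).ne')
  simp only [mul_assoc] at hp
  rw [integral_const_mul, hz] at hp
  simp at hp

lemma integral_insertNth {m : ℕ} (k : Fin (m + 1)) {F : (Fin (m + 1) → ℝ) → ℝ}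
    (hF : Integrable F) :
    ∫ x, F x = ∫ y : Fin m → ℝ, ∫ s : ℝ, F (k.insertNth s y) := by
  have hmp := (volume_preserving_piFinSuccAbove (fun _ : Fin (m + 1) => ℝ) k).symm
  have e := hmp.integral_comp' F
  have hi := (hmp.integrable_comp_emb (MeasurableEquiv.measurableEmbedding _)).2 hF
  rw [← e]
  rw [Measure.volume_eq_prod] at hi ⊢
  exact integral_prod_symm _ hi

lemma continuousOn_coef {J : Fin n → Set ℝ} (hJ : ∀ i, IsOpen (J i)) (k : Fin n) {ρ : ℝ → ℝ}
    (hρ : IsTest (J k) ρ) {u : (Fin n → ℝ) → ℝ} (hu : ContinuousOn u (Set.univ.pi J)) :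
    ContinuousOn (fun x => ∫ t, u (Function.update x k t) * ρ t) (Set.univ.pi J) := by
  have hO : IsOpen (Set.univ.pi J) := isOpen_set_pi Set.finite_univ fun i _ => hJ i
  refine continuousOn_integral_of_compact_support
    (f := fun x t => u (Function.update x k t) * ρ t) (k := tsupport ρ) hρ.cpt ?_ ?_
  · rintro ⟨x, t⟩ ⟨hx, -⟩
    apply ContinuousAt.continuousWithinAt
    by_cases ht : t ∈ tsupport ρ
    · have hm : Function.update x k t ∈ Set.univ.pi J := by
        intro j _
        by_cases hj : j = k
        · subst hj; simpa using hρ.supp ht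
        · simpa [hj] using hx j (Set.mem_univ j)
      refine ContinuousAt.mul ?_ (hρ.smooth.continuous.continuousAt.comp continuousAt_snd)
      have hc : Continuous (fun p : (Fin n → ℝ) × ℝ => Function.update p.1 k p.2) := by fun_prop
      exact ContinuousAt.comp (f := fun p : (Fin n → ℝ) × ℝ => Function.update p.1 k p.2) (x := (x, t))
        (hu.continuousAt (hO.mem_nhds hm)) hc.continuousAt
    · refine (continuousAt_const (y := (0 : ℝ))).congr ?_
      have : ∀ᶠ p : (Fin n → ℝ) × ℝ in nhds (x, t), p.2 ∈ (tsupport ρ)ᶜ :=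
        continuousAt_snd.eventually ((isClosed_tsupport ρ).isOpen_compl.mem_nhds ht)
      filter_upwards [this] with p hp
      simp [Function.uncurry, image_eq_zero_of_notMem_tsupport hp]
  · intro x t _ ht
    rw [image_eq_zero_of_notMem_tsupport ht, mul_zero]

lemma step {n : ℕ} {J : Fin n → Set ℝ} (hJ : ∀ i, IsOpen (J i)) (k : Fin n) {ρ : ℕ → ℝ → ℝ}
    (hρ : ∀ j, IsTest (J k) (ρ j)) (m : ℕ) {u : (Fin n → ℝ) → ℝ}
    (hu : ContinuousOn u (Set.univ.pi J)) {η : Fin n → ℝ → ℝ} (hη : ∀ i, IsTest (J i) (η i)) :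
    ∫ x, (u x - ∑ j ∈ Finset.range m, (∫ t, u (Function.update x k t) * ρ j t) * (x k) ^ j) *
        ∏ i, η i (x i) =
      ∫ x, u x * ∏ i, (Function.update η k
        (fun s => η k s - ∑ j ∈ Finset.range m, ρ j s * ∫ t, t ^ j * η k t)) i (x i) := by
  obtain _ | n := n
  · exact k.elim0
  have hO : IsOpen (Set.univ.pi J) := isOpen_set_pi Set.finite_univ fun i _ => hJ i
  have hQ : IsTest (J k) (fun s => η k s - ∑ j ∈ Finset.range m, ρ j s * ∫ t, t ^ j * η k t) :=
    (hη k).sub_sum (fun j => (hρ j).mul_const _) m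
  have hη' : ∀ i, IsTest (J i) ((Function.update η k
        (fun s => η k s - ∑ j ∈ Finset.range m, ρ j s * ∫ t, t ^ j * η k t)) i) := by
    intro i
    by_cases hi : i = k
    · subst hi; simpa using hQ
    · simpa [hi] using hη i
  have hcc : ContinuousOn (fun x => u x - ∑ j ∈ Finset.range m,
      (∫ t, u (Function.update x k t) * ρ j t) * (x k) ^ j) (Set.univ.pi J) :=
    hu.sub (continuousOn_finsetSum _
      fun j _ => (continuousOn_coef hJ k (hρ j) hu).mul (by fun_prop))
  rw [integral_insertNth k ((isTest_prod hη).integrable_mul hO hcc),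
    integral_insertNth k ((isTest_prod hη').integrable_mul hO hu)]
  congr 1
  ext y
  simp only [Fin.prod_univ_succAbove _ k, Fin.insertNth_apply_same, Fin.insertNth_apply_succAbove,
    Function.update_self, Function.update_of_ne (Fin.succAbove_ne k _), Fin.update_insertNth]
  simp only [← mul_assoc]
  rw [integral_mul_const, integral_mul_const]
  by_cases hy : ∏ i, η (k.succAbove i) (y i) = 0
  · rw [hy, mul_zero, mul_zero]
  congr 1
  have hyJ : ∀ i, y i ∈ J (k.succAbove i) := by
    intro i
    by_contra h'
    exact hy (Finset.prod_eq_zero (Finset.mem_univ i) ((hη _).zero_of_notMem h'))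
  have hv : ContinuousOn (fun s => u (k.insertNth s y)) (J k) := by
    refine hu.comp (f := fun s => k.insertNth s y) (Continuous.continuousOn ?_) ?_
    · fun_prop
    · intro s hs i _
      refine Fin.succAboveCases k ?_ (fun i => ?_) i
      · simpa using hs
      · simpa using hyJ i
  have i1 : Integrable (fun s => u (k.insertNth s y) * η k s) := (hη k).integrable_mul (hJ k) hv
  have i2 : ∀ j, Integrable (fun s => u (k.insertNth s y) * ρ j s) :=
    fun j => (hρ j).integrable_mul (hJ k) hv
  simp only [sub_mul, mul_sub, Finset.sum_mul, Finset.mul_sum]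
  rw [integral_sub i1, integral_sub i1, integral_finsetSum, integral_finsetSum]
  · congr 1
    refine Finset.sum_congr rfl fun j _ => ?_
    simp only [mul_assoc]
    rw [integral_const_mul]
    simp only [← mul_assoc]
    rw [integral_mul_const]
  · intro j _
    simpa only [mul_assoc] using (i2 j).mul_const _
  · intro j _
    simpa only [mul_assoc] using ((hη k).int_pow j).const_mul _
  · refine integrable_finsetSum _ fun j _ => ?_
    simpa only [mul_assoc] using (i2 j).mul_const _
  · refine integrable_finsetSum _ fun j _ => ?_
    simpa only [mul_assoc] using ((hη k).int_pow j).const_mul _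

lemma exists_decomp {J : Fin n → Set ℝ} (hJ : ∀ i, IsOpen (J i)) (α : Fin n → ℕ)
    (ρ : Fin n → ℕ → ℝ → ℝ) (hρ : ∀ i j, IsTest (J i) (ρ i j))
    (hd : ∀ k, ∀ i < α k, ∀ j < α k, ∫ s, s ^ j * ρ k i s = if i = j then 1 else 0)
    {u : (Fin n → ℝ) → ℝ} (hu : ContinuousOn u (Set.univ.pi J))
    (h0 : ∀ η : Fin n → ℝ → ℝ, (∀ i, IsTest (J i) (η i)) →
      (∀ i, ∀ j < α i, ∫ s, s ^ j * η i s = 0) → ∫ x, u x * ∏ i, η i (x i) = 0)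
    (S : Finset (Fin n)) :
    ∃ a : Fin n → ℕ → (Fin n → ℝ) → ℝ,
      (∀ k j, ContinuousOn (a k j) (Set.univ.pi J)) ∧
      (∀ k j (x : Fin n → ℝ) (t : ℝ), a k j (Function.update x k t) = a k j x) ∧
      ∀ η : Fin n → ℝ → ℝ, (∀ i, IsTest (J i) (η i)) →
        (∀ i ∉ S, ∀ j < α i, ∫ s, s ^ j * η i s = 0) →
        ∫ x, (u x - ∑ k : Fin n, ∑ j ∈ Finset.range (α k), a k j x * (x k) ^ j) *
          ∏ i, η i (x i) = 0 := by
  induction S using Finset.induction_on with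
  | empty =>
    refine ⟨fun _ _ _ => 0, fun _ _ => continuousOn_const, fun _ _ _ _ => rfl, ?_⟩
    intro η h1 h2
    simpa using h0 η h1 (fun i => h2 i (by simp))
  | insert k S hk ih =>
    obtain ⟨a, ha1, ha2, ha3⟩ := ih
    set w : (Fin n → ℝ) → ℝ :=
      fun x => u x - ∑ k : Fin n, ∑ j ∈ Finset.range (α k), a k j x * (x k) ^ j with hw
    have hwc : ContinuousOn w (Set.univ.pi J) := by
      refine hu.sub (continuousOn_finsetSum _ fun i _ => continuousOn_finsetSum _ fun j _ =>
        (ha1 i j).mul (by fun_prop))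
    let A : ℕ → (Fin n → ℝ) → ℝ := fun j x => ∫ t, w (Function.update x k t) * ρ k j t
    refine ⟨fun i j x => a i j x + if i = k then A j x else 0, ?_, ?_, ?_⟩
    · intro i j
      by_cases hi : i = k
      · simp only [hi, if_true]
        exact (ha1 k j).add (continuousOn_coef hJ k (hρ k j) hwc)
      · simpa [hi] using ha1 i j
    · intro i j x t
      by_cases hi : i = k
      · subst hi; simp [ha2, A]
      · simp [hi, ha2]
    · intro η h1 h2
      have e : ∀ x, u x - ∑ i : Fin n, ∑ j ∈ Finset.range (α i),
          (a i j x + if i = k then A j x else 0) * (x i) ^ j =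
          w x - ∑ j ∈ Finset.range (α k), A j x * (x k) ^ j := by
        intro x
        simp only [hw, add_mul, Finset.sum_add_distrib, sub_sub]
        congr 2
        rw [Finset.sum_eq_single k]
        · simp
        · intro i _ hi; simp [hi]
        · simp
      simp only [e]
      rw [step hJ k (hρ k) (α k) hwc h1]
      apply ha3
      · intro i
        by_cases hi : i = k
        · subst hi
          simpa using (h1 i).sub_sum (fun j => (hρ i j).mul_const _) (α i)
        · simpa [hi] using h1 i
      · intro i hi j hj
        by_cases hik : i = k
        · subst hik
          simp only [Function.update_self, mul_sub, Finset.mul_sum]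
          have ii : ∀ l, Integrable fun s : ℝ => s ^ j * (ρ i l s * ∫ t, t ^ l * η i t) := by
            intro l
            simpa only [mul_assoc] using ((hρ i l).int_pow j).mul_const (∫ t, t ^ l * η i t)
          rw [integral_sub ((h1 i).int_pow j) (integrable_finsetSum _ fun l _ => ii l),
            integral_finsetSum _ fun l _ => ii l, Finset.sum_eq_single j]
          · simp only [← mul_assoc]
            rw [integral_mul_const, hd i j hj j hj]
            simp
          · intro l hl hlj
            simp only [← mul_assoc]
            rw [integral_mul_const, hd i l (Finset.mem_range.1 hl) j hj]
            simp [hlj]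
          · intro h; exact absurd (Finset.mem_range.2 hj) h
        · rw [Function.update_of_ne hik]
          exact h2 i (by simp [hik, hi]) j hj

lemma integral_term_zero (hO : IsOpen U) (k : Fin n) {m j : ℕ} (hj : j < m)
    {b : (Fin n → ℝ) → ℝ} (hb : ContinuousOn b U)
    (hinv : ∀ (x : Fin n → ℝ) (t : ℝ), b (Function.update x k t) = b x)
    (hφ : IsTest U φ) : ∫ x, (b x * (x k) ^ j) * (pd k)^[m] φ x = 0 := by
  obtain _ | n := n
  · exact k.elim0
  have hcc : ContinuousOn (fun x => b x * (x k) ^ j) U := hb.mul (by fun_prop)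
  rw [integral_insertNth k ((hφ.pd_iter k m).integrable_mul hO hcc)]
  refine integral_eq_zero_of_ae (Filter.Eventually.of_forall fun y => ?_)
  have hb' : ∀ s, b (k.insertNth s y) = b (k.insertNth 0 y) := by
    intro s
    rw [← hinv (k.insertNth 0 y) s, Fin.update_insertNth]
  have hp : ∀ s, (pd k)^[m] φ (k.insertNth s y) =
      iteratedDeriv m (fun s => φ (k.insertNth s y)) s := by
    intro s
    have := pd_iter_apply k m φ (k.insertNth 0 y) s
    simpa only [Fin.update_insertNth] using this
  have hsl : IsTest Set.univ (fun s => φ (k.insertNth s y)) := by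
    refine ⟨hφ.smooth.comp ?_, ?_, Set.subset_univ _⟩
    · rw [contDiff_pi]
      intro i
      refine Fin.succAboveCases k ?_ (fun i => ?_) i
      · simpa using contDiff_fun_id
      · simpa using contDiff_const
    · refine HasCompactSupport.of_support_subset_isCompact
        (hφ.cpt.isCompact.image (continuous_apply k)) ?_
      intro s hs
      exact ⟨k.insertNth s y, subset_tsupport _ hs, by simp⟩
  simp only [hb', hp, Fin.insertNth_apply_same, mul_assoc]
  rw [integral_const_mul, moment_iteratedDeriv hsl m j hj]
  simp

end nD

/-- On an open box `U`, the distributional derivatives `D^α f` and `D^α g` of two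
continuous functions agree iff `f - g = θ₁ + ⋯ + θₙ` where each `θₖ` is a polynomial in
`xₖ` of degree `< αₖ` whose coefficients are continuous functions on `U` not depending
on `xₖ`. -/
theorem distributional_deriv_eq_iff {n : ℕ} (c : Fin n → ℝ) (r : ℝ) (hr : 0 < r)
    (U : Set (Fin n → ℝ))
    (hU : U = Set.univ.pi fun i => Set.Ioo (c i - r) (c i + r))
    (α : Fin n → ℕ) (f g : (Fin n → ℝ) → ℝ)
    (hf : ContinuousOn f U) (hg : ContinuousOn g U) :
    (∀ φ : (Fin n → ℝ) → ℝ, ContDiff ℝ (⊤ : ℕ∞) φ → HasCompactSupport φ → tsupport φ ⊆ U →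
      ∫ x in U, f x * multiPD α φ x = ∫ x in U, g x * multiPD α φ x) ↔
    (∃ a : Fin n → ℕ → (Fin n → ℝ) → ℝ,
      (∀ k j, ContinuousOn (a k j) U) ∧
      (∀ k j (x : Fin n → ℝ) (t : ℝ), a k j (Function.update x k t) = a k j x) ∧
      ∀ x ∈ U, f x - g x =
        ∑ k : Fin n, ∑ j ∈ Finset.range (α k), a k j x * (x k) ^ j) := by
  have hO : IsOpen U := by
    rw [hU]; exact isOpen_set_pi Set.finite_univ fun i _ => isOpen_Ioo
  have hsub : ContinuousOn (fun x => f x - g x) U := hf.sub hg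
  have key : ∀ φ : (Fin n → ℝ) → ℝ, IsTest U φ →
      ((∫ x in U, f x * multiPD α φ x = ∫ x in U, g x * multiPD α φ x) ↔
        ∫ x, (f x - g x) * multiPD α φ x = 0) := by
    intro φ h
    have hT : IsTest U (multiPD α φ) := h.foldr α _
    rw [hT.setIntegral, hT.setIntegral]
    simp only [sub_mul]
    rw [integral_sub (hT.integrable_mul hO hf) (hT.integrable_mul hO hg), sub_eq_zero]
  constructor
  · intro H
    choose ρ h1 h2 using fun k => exists_dual (c k) hr (α k)
    subst hU
    obtain ⟨a, ha1, ha2, ha3⟩ := exists_decomp (fun i => isOpen_Ioo) α ρ h1 h2 hsub (by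
      intro η hη hm
      choose ψ hψ hψ' using fun i => exists_iter_primitive (α i) (hη i) (hm i)
      have hT := isTest_prod hψ
      have := (key _ hT).1 (H _ hT.smooth hT.cpt hT.supp)
      rw [multiPD_prod] at this
      simpa only [hψ'] using this) Finset.univ
    refine ⟨a, ha1, ha2, fun x hx => ?_⟩
    have := eq_zero_of_test (fun i => isOpen_Ioo) (u := fun x => (f x - g x) -
      ∑ k : Fin n, ∑ j ∈ Finset.range (α k), a k j x * (x k) ^ j)
      (hsub.sub (continuousOn_finsetSum _ fun i _ => continuousOn_finsetSum _ fun j _ =>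
        (ha1 i j).mul (by fun_prop))) (fun η hη => ha3 η hη (by simp)) x hx
    exact sub_eq_zero.1 this
  · rintro ⟨a, ha1, ha2, ha3⟩ φ hφ1 hφ2 hφ3
    have hφ : IsTest U φ := ⟨hφ1, hφ2, hφ3⟩
    rw [key φ hφ]
    have hT : IsTest U (multiPD α φ) := hφ.foldr α _
    have e : ∀ x, (f x - g x) * multiPD α φ x = ∑ k : Fin n, ∑ j ∈ Finset.range (α k),
        (a k j x * (x k) ^ j) * multiPD α φ x := by
      intro x
      by_cases hx : x ∈ U
      · rw [ha3 x hx]; simp only [Finset.sum_mul]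
      · simp [hT.zero_of_notMem hx]
    simp only [e]
    have hi : ∀ k j, Integrable (fun x => (a k j x * (x k) ^ j) * multiPD α φ x) :=
      fun k j => hT.integrable_mul hO ((ha1 k j).mul (by fun_prop))
    rw [integral_finsetSum _ fun k _ => integrable_finsetSum _ fun j _ => hi k j]
    refine Finset.sum_eq_zero fun k _ => ?_
    rw [integral_finsetSum _ fun j _ => hi k j]
    refine Finset.sum_eq_zero fun j hj => ?_
    obtain ⟨ψ, hψ, hψ'⟩ := foldr_extract α k (List.finRange n) hφ (List.mem_finRange k)
    rw [multiPD, hψ']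
    exact integral_term_zero hO k (Finset.mem_range.1 hj) (ha1 k j) (ha2 k j) hψ
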